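/- Let γ̃ ∈ Υ with |γ̃'(z)| ≤ 8 for all z ≥ 0, set γ = 𝔗γ̃ = 1 − (1 − γ̃)², and define γ̂(z) = γ(z) + (z − 1)γ'(z). Then: (i) γ̂ vanishes outside [1/2, 3/2] and γ̂ ≡ 1 on [3/4, 5/4]; (ii) |1 − γ̂(z)| ≤ 9 (1 − γ̃(z)) for all z ≥ 0; (iii) |γ̂(z)| ≤ 9 for all z ≥ 0; (iv) 0 ≤ z |γ̂(z)| ≤ 27/2 for all z ≥ 0. -/

import Mathlib

/-- The class `Υ` of `C¹` bump functions `γ : [0,∞) → [0,1]` with `γ ≡ 1` on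
`[3/4, 5/4]` and `γ = 0` outside `[1/2, 3/2]` (here extended as `C¹` functions on `ℝ`,
the defining properties being required for `z ≥ 0`). -/
def IsBump (γ : ℝ → ℝ) : Prop :=
  ContDiff ℝ 1 γ ∧ (∀ z, 0 ≤ z → γ z ∈ Set.Icc (0 : ℝ) 1) ∧
    (∀ z ∈ Set.Icc (3 / 4 : ℝ) (5 / 4), γ z = 1) ∧
    (∀ z, 0 ≤ z → z ∉ Set.Icc (1 / 2 : ℝ) (3 / 2) → γ z = 0)

/-- A differentiable function vanishing at all `z ≥ 0` in an open set has vanishing derivative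
there, including at the endpoint `0`. -/
theorem deriv_eq_zero_of_forall_nonneg {f : ℝ → ℝ} {s : Set ℝ} (hs : IsOpen s)
    (hf : Differentiable ℝ f) (h : ∀ z, 0 ≤ z → z ∈ s → f z = 0) {z : ℝ} (hz : 0 ≤ z)
    (hzs : z ∈ s) : deriv f z = 0 := by
  have h₁ : HasDerivWithinAt f (deriv f z) (Set.Ici z) z := (hf z).hasDerivAt.hasDerivWithinAt
  have h₂ : HasDerivWithinAt f 0 (Set.Ici z) z := by
    refine (hasDerivWithinAt_const z (Set.Ici z) (0 : ℝ)).congr_of_eventuallyEq ?_ (h z hz hzs)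
    filter_upwards [self_mem_nhdsWithin, mem_nhdsWithin_of_mem_nhds (hs.mem_nhds hzs)] with w hw hws
    exact h w (hz.trans hw) hws
  exact (uniqueDiffOn_Ici z z Set.self_mem_Ici).eq_deriv _ h₁ h₂

/-- **Properties of `γ̂`.** Let `γ̃ ∈ Υ₈`, `γ = 𝔗γ̃ = 1 − (1 − γ̃)²`, and
`γ̂(z) = γ(z) + (z − 1)γ'(z)`. Then (i) `γ̂` vanishes outside `[1/2, 3/2]` and
`γ̂ ≡ 1` on `[3/4, 5/4]`; (ii) `|1 − γ̂(z)| ≤ 9 (1 − γ̃(z))`; (iii) `|γ̂(z)| ≤ 9`;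
(iv) `0 ≤ z|γ̂(z)| ≤ 27/2`, for all `z ≥ 0`. -/
theorem hat_bump_properties
    (γt : ℝ → ℝ) (hγt : IsBump γt) (hγt' : ∀ z, 0 ≤ z → |deriv γt z| ≤ 8)
    (γ : ℝ → ℝ) (hγ : γ = fun z => 1 - (1 - γt z) ^ 2)
    (γhat : ℝ → ℝ) (hγhat : γhat = fun z => γ z + (z - 1) * deriv γ z) :
    (∀ z, 0 ≤ z → z ∉ Set.Icc (1 / 2 : ℝ) (3 / 2) → γhat z = 0) ∧
    (∀ z ∈ Set.Icc (3 / 4 : ℝ) (5 / 4), γhat z = 1) ∧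
    (∀ z, 0 ≤ z → |1 - γhat z| ≤ 9 * (1 - γt z)) ∧
    (∀ z, 0 ≤ z → |γhat z| ≤ 9) ∧
    (∀ z, 0 ≤ z → 0 ≤ z * |γhat z| ∧ z * |γhat z| ≤ 27 / 2) := by
  obtain ⟨hC, hmem, hone, hzero⟩ := hγt
  have hd : Differentiable ℝ γt := hC.differentiable one_ne_zero
  have hhat : ∀ z, γhat z =
      1 - (1 - γt z) ^ 2 + (z - 1) * (2 * (1 - γt z) * deriv γt z) := by
    intro z
    have h : HasDerivAt γ (2 * (1 - γt z) * deriv γt z) z := by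
      rw [hγ]
      refine ((((hd z).hasDerivAt.const_sub 1).pow 2).const_sub 1).congr_deriv ?_
      norm_num
    rw [hγhat]
    simp only [h.deriv]
    rw [hγ]
  have hvanish : ∀ z, 0 ≤ z → z ∉ Set.Icc (1 / 2 : ℝ) (3 / 2) → γhat z = 0 := by
    intro z hz hzs
    rw [hhat, hzero z hz hzs,
      deriv_eq_zero_of_forall_nonneg isClosed_Icc.isOpen_compl hd hzero hz hzs]
    norm_num
  have hprod : ∀ z, 0 ≤ z → z ∈ Set.Icc (1 / 2 : ℝ) (3 / 2) →
      |(z - 1) * deriv γt z| ≤ 4 := by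
    intro z hz hzs
    have h₁ : |z - 1| ≤ 1 / 2 := abs_le.2 ⟨by linarith [hzs.1], by linarith [hzs.2]⟩
    rw [abs_mul]
    calc |z - 1| * |deriv γt z| ≤ 1 / 2 * 8 :=
          mul_le_mul h₁ (hγt' z hz) (abs_nonneg _) (by norm_num)
      _ = 4 := by norm_num
  have hbound : ∀ z, 0 ≤ z → |γhat z| ≤ 9 := by
    intro z hz
    by_cases hzs : z ∈ Set.Icc (1 / 2 : ℝ) (3 / 2)
    · obtain ⟨h₀, h₁⟩ := hmem z hz
      obtain ⟨h₂, h₃⟩ := abs_le.1 (hprod z hz hzs)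
      rw [hhat, abs_le]
      constructor <;> nlinarith
    · rw [hvanish z hz hzs]
      norm_num
  refine ⟨hvanish, ?_, ?_, hbound, ?_⟩
  · intro z hz
    rw [hhat, hone z hz]
    norm_num
  · intro z hz
    by_cases hzs : z ∈ Set.Icc (1 / 2 : ℝ) (3 / 2)
    · obtain ⟨h₀, h₁⟩ := hmem z hz
      obtain ⟨h₂, h₃⟩ := abs_le.1 (hprod z hz hzs)
      rw [hhat, abs_le]
      constructor <;> nlinarith
    · rw [hvanish z hz hzs, hzero z hz hzs]
      norm_num
  · intro z hz
    refine ⟨by positivity, ?_⟩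
    by_cases hzs : z ∈ Set.Icc (1 / 2 : ℝ) (3 / 2)
    · calc z * |γhat z| ≤ 3 / 2 * 9 :=
            mul_le_mul hzs.2 (hbound z hz) (abs_nonneg _) (by norm_num)
        _ = 27 / 2 := by norm_num
    · rw [hvanish z hz hzs]
      norm_num
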